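/- arXiv:2003.03673 — 3 statements merged into one kernel-verified Lean document; each statement's English description precedes it below -/
import Mathlib

section
/- Let N ≥ 3 be an integer, Ω ⊆ ℝ^N an open set, ε ∈ ℝ, and let u : Ω → ℝ be twice continuously differentiable with u > 0 on Ω and −Δu = u^{(N+2)/(N−2)} + ε u on Ω. Let x₀ ∈ ℝ^N and r > 0 be such that the closed ball of center x₀ and radius r is contained in Ω, and let ν(x) = (x−x₀)/r denote the outward unit normal of the sphere ∂B_r(x₀). Then for every i ∈ {1,…,N}: −∫_{∂B_r(x₀)} (∂u/∂ν)(∂u/∂x_i) dσ + (1/2)∫_{∂B_r(x₀)} |∇u|² ν_i dσ = ((N−2)/(2N))∫_{∂B_r(x₀)} u^{2N/(N−2)} ν_i dσ + (ε/2)∫_{∂B_r(x₀)} u² ν_i dσ, where all boundary integrals are taken with respect to the (N−1)-dimensional Hausdorff (surface) measure on ∂B_r(x₀). -/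
open MeasureTheory Metric Real
open scoped RealInnerProductSpace ENNReal

/-- The Euclidean Laplacian `Δu = Σ_{i=1}^N ∂²u/∂x_i²` on `ℝ^N`. -/
noncomputable def laplacian {N : ℕ} (u : EuclideanSpace ℝ (Fin N) → ℝ)
    (x : EuclideanSpace ℝ (Fin N)) : ℝ :=
  ∑ i : Fin N, fderiv ℝ (fun y => fderiv ℝ u y (EuclideanSpace.single i 1)) x
    (EuclideanSpace.single i 1)

/-- The point of `ℝ^ι` with `i`-th coordinate `s` and the other coordinates given by `p`. -/
noncomputable def facePoint {ι : Type*} [DecidableEq ι] (i : ι) (s : ℝ) (p : {j // j ≠ i} → ℝ) :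
    EuclideanSpace ℝ ι :=
  WithLp.toLp 2 fun j => if h : j ≠ i then p ⟨j, h⟩ else s

theorem contDiff_facePoint {ι : Type*} [Fintype ι] [DecidableEq ι] (i : ι) (s : ℝ) :
    ContDiff ℝ 1 (facePoint i s) := by
  rw [contDiff_euclidean]
  intro j
  by_cases h : j ≠ i
  · simpa [facePoint, h] using contDiff_apply ℝ ℝ (⟨j, h⟩ : {j // j ≠ i})
  · rw [not_not] at h
    simp [facePoint, h, contDiff_const]

theorem facePoint_ne_zero {ι : Type*} [Fintype ι] [DecidableEq ι] (i : ι) {s : ℝ} (hs : s ≠ 0)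
    (p : {j // j ≠ i} → ℝ) : facePoint i s p ≠ 0 := by
  intro h
  apply hs
  simpa [facePoint] using congrArg (fun x : EuclideanSpace ℝ ι => x i) h

/-- The sphere in `ℝ^N` has finite `(N - 1)`-dimensional Hausdorff measure. -/
theorem hausdorffMeasure_sphere_lt_top {N : ℕ} (x₀ : EuclideanSpace ℝ (Fin N))
    {r : ℝ} (hr : 0 < r) : μH[(N : ℝ) - 1] (sphere x₀ r) < ∞ := by
  let g (i : Fin N) (s : ℝ) (p : {j // j ≠ i} → ℝ) : EuclideanSpace ℝ (Fin N) :=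
    x₀ + (r * ‖facePoint i s p‖⁻¹) • facePoint i s p
  have hfin (i : Fin N) (s : ℝ) (hs : s ≠ 0) :
      μH[(N : ℝ) - 1] (g i s '' closedBall 0 1) < ∞ := by
    have hg : ContDiff ℝ 1 (g i s) := by
      have hv := contDiff_facePoint i s
      have hn : ContDiff ℝ 1 fun p => ‖facePoint i s p‖ :=
        hv.norm ℝ fun p => facePoint_ne_zero i hs p
      have hn' : ContDiff ℝ 1 fun p => ‖facePoint i s p‖⁻¹ :=
        hn.inv fun p => norm_ne_zero_iff.2 (facePoint_ne_zero i hs p)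
      exact contDiff_const.add ((contDiff_const.mul hn').smul hv)
    obtain ⟨K, hK⟩ := hg.contDiffOn.exists_lipschitzOnWith one_ne_zero
      (convex_closedBall (0 : {j // j ≠ i} → ℝ) 1) (isCompact_closedBall _ _)
    have hcard : ((Fintype.card {j // j ≠ i} : ℕ) : ℝ) = (N : ℝ) - 1 := by
      have : 1 ≤ N := Nat.one_le_iff_ne_zero.2 fun h => by subst h; exact i.elim0
      simp [Fintype.card_subtype_compl, Nat.cast_sub this]
    have hle := hK.hausdorffMeasure_image_le (d := (N : ℝ) - 1) (by rw [← hcard]; positivity)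
    refine hle.trans_lt (ENNReal.mul_lt_top ?_ ?_)
    · exact ENNReal.rpow_lt_top_of_nonneg (by rw [← hcard]; positivity) ENNReal.coe_ne_top
    · rw [← hcard, hausdorffMeasure_pi_real]
      exact measure_closedBall_lt_top
  have hcover : sphere x₀ r ⊆
      ⋃ i : Fin N, (g i 1 '' closedBall 0 1 ∪ g i (-1) '' closedBall 0 1) := by
    intro x hx
    rw [mem_sphere_iff_norm] at hx
    have hne : x - x₀ ≠ 0 := by
      rw [← norm_ne_zero_iff, hx]; exact hr.ne'
    have : Nonempty (Fin N) := by
      by_contra h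
      rw [not_nonempty_iff] at h
      exact hne (Subsingleton.elim _ _)
    obtain ⟨i, hi⟩ := Finite.exists_max fun j => |(x - x₀) j|
    have hipos : 0 < |(x - x₀) i| := by
      by_contra h
      apply hne
      ext j
      have := (hi j).trans (not_lt.1 h)
      simpa using abs_nonpos_iff.1 this
    have hcoord : (x - x₀) i ≠ 0 := abs_pos.1 hipos
    have key (s : ℝ) (hs : |(x - x₀) i| * s = (x - x₀) i) : x ∈ g i s '' closedBall 0 1 := by
      refine ⟨fun j => |(x - x₀) i|⁻¹ * (x - x₀) j, ?_, ?_⟩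
      · rw [mem_closedBall_zero_iff, pi_norm_le_iff_of_nonneg zero_le_one]
        intro j
        rw [norm_mul, norm_inv, Real.norm_eq_abs, Real.norm_eq_abs, abs_abs,
          inv_mul_le_one₀ hipos]
        exact hi j
      · have hface : facePoint i s (fun j => |(x - x₀) i|⁻¹ * (x - x₀) j)
            = |(x - x₀) i|⁻¹ • (x - x₀) := by
          ext j
          by_cases h : j = i
          · subst h
            simp only [facePoint, ne_eq, not_true_eq_false, dite_false, PiLp.smul_apply,
              smul_eq_mul]
            rw [eq_inv_mul_iff_mul_eq₀ hipos.ne', hs]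
          · simp [facePoint, h]
        simp only [g, hface]
        rw [norm_smul, hx, norm_inv, Real.norm_eq_abs, abs_abs, smul_smul]
        have : r * (|(x - x₀) i|⁻¹ * r)⁻¹ * |(x - x₀) i|⁻¹ = 1 := by field_simp
        rw [this, one_smul, add_sub_cancel]
    refine Set.mem_iUnion.2 ⟨i, ?_⟩
    rcases lt_or_gt_of_ne hcoord with h | h
    · exact Or.inr (key _ (by rw [abs_of_neg h]; ring))
    · exact Or.inl (key _ (by rw [abs_of_pos h]; ring))
  refine (measure_mono hcover).trans_lt ((measure_iUnion_le _).trans_lt ?_)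
  rw [tsum_fintype]
  exact ENNReal.sum_lt_top.2 fun i _ =>
    measure_union_lt_top (hfin i 1 one_ne_zero) (hfin i (-1) (by norm_num))

theorem ContinuousOn.integrableOn_sphere_hausdorffMeasure {N : ℕ} {x₀ : EuclideanSpace ℝ (Fin N)}
    {r : ℝ} (hr : 0 < r) {f : EuclideanSpace ℝ (Fin N) → ℝ} (hf : ContinuousOn f (sphere x₀ r)) :
    IntegrableOn f (sphere x₀ r) μH[(N : ℝ) - 1] := by
  obtain ⟨C, hC⟩ := (isCompact_sphere x₀ r).exists_bound_of_continuousOn hf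
  exact IntegrableOn.of_bound (hausdorffMeasure_sphere_lt_top x₀ hr)
    (hf.aestronglyMeasurable isClosed_sphere.measurableSet) C
    ((ae_restrict_iff' isClosed_sphere.measurableSet).2 (Filter.Eventually.of_forall hC))

theorem exists_isometryEquiv_fixing {E : Type*} [NormedAddCommGroup E] [InnerProductSpace ℝ E]
    {x₀ y z : E} (h : ‖y - x₀‖ = ‖z - x₀‖) :
    ∃ e : E ≃ᵢ E, e x₀ = x₀ ∧ e y = z := by
  let A := (ℝ ∙ ((y - x₀) - (z - x₀)))ᗮ.reflection
  refine ⟨((IsometryEquiv.subRight x₀).trans A.toIsometryEquiv).trans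
    (IsometryEquiv.addRight x₀), ?_, ?_⟩
  · simp
  · have : A (y - x₀) = z - x₀ := Submodule.reflection_sub h
    simp [this]

/-- The integral of a kernel `η (dist x y)` over a sphere depends only on the distance of `y` to the
center. -/
theorem setIntegral_sphere_dist_eq {E : Type*} [NormedAddCommGroup E] [InnerProductSpace ℝ E]
    [MeasurableSpace E] [BorelSpace E] (d : ℝ) (η : ℝ → ℝ) (r : ℝ) {x₀ y z : E}
    (h : ‖y - x₀‖ = ‖z - x₀‖) :
    ∫ x in sphere x₀ r, η (dist x y) ∂μH[d] = ∫ x in sphere x₀ r, η (dist x z) ∂μH[d] := by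
  obtain ⟨e, he₀, he⟩ := exists_isometryEquiv_fixing h
  have hpre : e ⁻¹' sphere x₀ r = sphere x₀ r := by
    rw [e.preimage_sphere, ← he₀, e.symm_apply_apply, he₀]
  have := (e.measurePreserving_hausdorffMeasure d).setIntegral_preimage_emb
    e.toHomeomorph.measurableEmbedding (fun x => η (dist x z)) (sphere x₀ r)
  rw [← this, hpre]
  simp [← he, e.isometry.dist_eq]

theorem integral_fderiv_apply_eq_zero {E : Type*} [NormedAddCommGroup E] [NormedSpace ℝ E]
    [FiniteDimensional ℝ E] [MeasurableSpace E] [BorelSpace E] {μ : Measure E}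
    [μ.IsAddHaarMeasure] {f : E → ℝ} (hf : ContDiff ℝ 1 f) (hs : HasCompactSupport f) (v : E) :
    ∫ x, fderiv ℝ f x v ∂μ = 0 := by
  have hf' : Continuous fun x => fderiv ℝ f x v :=
    (hf.continuous_fderiv one_ne_zero).clm_apply continuous_const
  have hs' : HasCompactSupport fun x => fderiv ℝ f x v :=
    hs.fderiv_apply (𝕜 := ℝ) v
  have := integral_mul_fderiv_eq_neg_fderiv_mul_of_integrable (μ := μ) (f := fun _ : E => (1 : ℝ))
    (g := f) (v := v) (by simp) (by simpa using hf'.integrable_of_hasCompactSupport hs')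
    (by simpa using hf.continuous.integrable_of_hasCompactSupport hs)
    (fun x _ => differentiableAt_const _) (fun x _ => hf.differentiable one_ne_zero x)
  simpa using this

/-- A divergence-free field has zero weighted radial flux, for each continuous radial weight with
support in a closed ball on a neighbourhood of which the field is defined. -/
theorem integral_radial_mul_flux_eq_zero {N : ℕ} {Ω : Set (EuclideanSpace ℝ (Fin N))}
    (hΩ : IsOpen Ω) {F : Fin N → EuclideanSpace ℝ (Fin N) → ℝ}
    (hF : ∀ j, ContDiffOn ℝ 1 (F j) Ω)
    (hdiv : ∀ x ∈ Ω, ∑ j, fderiv ℝ (F j) x (EuclideanSpace.single j 1) = 0)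
    {x₀ : EuclideanSpace ℝ (Fin N)} {R : ℝ} (hR : 0 ≤ R) (hball : closedBall x₀ R ⊆ Ω)
    {h : ℝ → ℝ} (hh : Continuous h) (hh0 : ∀ t, R ^ 2 ≤ t → h t = 0) :
    ∫ y, h (‖y - x₀‖ ^ 2) * ∑ j, F j y * (y - x₀) j = 0 := by
  let g : ℝ → ℝ := fun t => ∫ s in (R ^ 2)..t, h s
  have hgd (t : ℝ) : HasDerivAt g (h t) t :=
    intervalIntegral.integral_hasDerivAt_right (hh.intervalIntegrable _ _)
      hh.stronglyMeasurable.stronglyMeasurableAtFilter hh.continuousAt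
  have hg0 (t : ℝ) (ht : R ^ 2 ≤ t) : g t = 0 := by
    refine intervalIntegral.integral_zero_ae (Filter.Eventually.of_forall fun s hs => ?_)
    rw [Set.uIoc_of_le ht] at hs
    exact hh0 s hs.1.le
  have hg : ContDiff ℝ 1 g := by
    rw [contDiff_one_iff_deriv]
    refine ⟨fun t => (hgd t).differentiableAt, ?_⟩
    rwa [funext fun t => (hgd t).deriv]
  let χ : EuclideanSpace ℝ (Fin N) → ℝ := fun y => g (‖y - x₀‖ ^ 2)
  have hχ : ContDiff ℝ 1 χ := hg.comp ((contDiff_id.sub contDiff_const).norm_sq ℝ)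
  have hχd (y v : EuclideanSpace ℝ (Fin N)) :
      fderiv ℝ χ y v = 2 * h (‖y - x₀‖ ^ 2) * ⟪y - x₀, v⟫ := by
    have h1 : HasFDerivAt (fun y => ‖y - x₀‖ ^ 2) (2 • innerSL ℝ (y - x₀)) y := by
      simpa using ((hasFDerivAt_id y).sub_const x₀).norm_sq
    have h2 : HasFDerivAt χ _ y := (hgd _).comp_hasFDerivAt y h1
    rw [h2.fderiv]
    simp [inner_sub_left]
    ring
  have hout (y : EuclideanSpace ℝ (Fin N)) (hy : y ∉ closedBall x₀ R) : χ y = 0 := by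
    refine hg0 _ ?_
    rw [mem_closedBall_iff_norm, not_le] at hy
    gcongr
  have hprod (j : Fin N) : ContDiff ℝ 1 fun y => χ y * F j y := by
    rw [contDiff_iff_contDiffAt]
    intro y
    by_cases hy : y ∈ Ω
    · exact hχ.contDiffAt.mul ((hF j).contDiffAt (hΩ.mem_nhds hy))
    · have hev : (fun y => χ y * F j y) =ᶠ[nhds y] fun _ => 0 := by
        filter_upwards [isClosed_closedBall.isOpen_compl.mem_nhds fun h => hy (hball h)] with z hz
        rw [hout z hz, zero_mul]
      exact contDiffAt_const.congr_of_eventuallyEq hev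
  have hsupp (j : Fin N) : HasCompactSupport fun y => χ y * F j y :=
    HasCompactSupport.intro (isCompact_closedBall x₀ R) fun y hy => by rw [hout y hy, zero_mul]
  have hpt (y : EuclideanSpace ℝ (Fin N)) :
      ∑ j, fderiv ℝ (fun y => χ y * F j y) y (EuclideanSpace.single j 1)
        = 2 * (h (‖y - x₀‖ ^ 2) * ∑ j, F j y * (y - x₀) j) := by
    by_cases hy : y ∈ Ω
    · have hterm (j : Fin N) : fderiv ℝ (fun y => χ y * F j y) y (EuclideanSpace.single j 1)
          = χ y * fderiv ℝ (F j) y (EuclideanSpace.single j 1)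
            + 2 * h (‖y - x₀‖ ^ 2) * (F j y * (y - x₀) j) := by
        rw [fderiv_fun_mul (hχ.differentiable one_ne_zero y)
          (((hF j).contDiffAt (hΩ.mem_nhds hy)).differentiableAt one_ne_zero)]
        simp only [add_apply, smul_apply, smul_eq_mul, hχd]
        rw [EuclideanSpace.inner_single_right]
        simp
        ring
      rw [Finset.sum_congr rfl fun j _ => hterm j, Finset.sum_add_distrib, ← Finset.mul_sum,
        ← Finset.mul_sum, hdiv y hy]
      ring
    · have hy' : y ∉ closedBall x₀ R := fun h => hy (hball h)
      have hev (j : Fin N) : (fun y => χ y * F j y) =ᶠ[nhds y] fun _ => 0 := by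
        filter_upwards [isClosed_closedBall.isOpen_compl.mem_nhds hy'] with z hz
        rw [hout z hz, zero_mul]
      have h0 : h (‖y - x₀‖ ^ 2) = 0 := by
        apply hh0
        rw [mem_closedBall_iff_norm, not_le] at hy'
        gcongr
      rw [h0, Finset.sum_eq_zero fun j _ => by rw [(hev j).fderiv_eq]; simp]
      ring
  have hinteg (j : Fin N) : Integrable fun y =>
      fderiv ℝ (fun y => χ y * F j y) y (EuclideanSpace.single j 1) :=
    (((hprod j).continuous_fderiv one_ne_zero).clm_apply
      continuous_const).integrable_of_hasCompactSupport ((hsupp j).fderiv_apply (𝕜 := ℝ) _)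
  have hsum := integral_finsetSum (μ := volume) Finset.univ fun j _ => hinteg j
  rw [Finset.sum_eq_zero fun j _ => integral_fderiv_apply_eq_zero (hprod j) (hsupp j) _] at hsum
  simp_rw [hpt, integral_const_mul] at hsum
  linarith

/-- The flux of a divergence-free `C^1` field through a sphere vanishes. -/
theorem setIntegral_sphere_flux_eq_zero {N : ℕ} (hN : 1 ≤ N) {Ω : Set (EuclideanSpace ℝ (Fin N))}
    (hΩ : IsOpen Ω) {F : Fin N → EuclideanSpace ℝ (Fin N) → ℝ}
    (hF : ∀ j, ContDiffOn ℝ 1 (F j) Ω)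
    (hdiv : ∀ x ∈ Ω, ∑ j, fderiv ℝ (F j) x (EuclideanSpace.single j 1) = 0)
    {x₀ : EuclideanSpace ℝ (Fin N)} {r : ℝ} (hr : 0 < r) (hball : closedBall x₀ r ⊆ Ω) :
    ∫ x in sphere x₀ r, ∑ j, F j x * (x - x₀) j ∂μH[(N : ℝ) - 1] = 0 := by
  set f : EuclideanSpace ℝ (Fin N) → ℝ := fun x => ∑ j, F j x * (x - x₀) j with hf
  set μ : Measure (EuclideanSpace ℝ (Fin N)) := μH[(N : ℝ) - 1].restrict (sphere x₀ r) with hμ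
  have hμfin : IsFiniteMeasure μ :=
    ⟨by rw [hμ, Measure.restrict_apply_univ]; exact hausdorffMeasure_sphere_lt_top x₀ hr⟩
  have hfc : ContinuousOn f Ω := by
    refine continuousOn_finsetSum _ fun j _ => (hF j).continuousOn.mul ?_
    fun_prop
  obtain ⟨ρ₀, hρ₀, hρ₀Ω⟩ := (isCompact_closedBall x₀ r).exists_cthickening_subset_open hΩ hball
  rw [cthickening_closedBall hρ₀.le hr.le] at hρ₀Ω
  have hle (δ : ℝ) (hδ : 0 < δ) : |∫ x, f x ∂μ| ≤ δ * μ.real Set.univ := by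
    have huc : UniformContinuousOn f (closedBall x₀ (ρ₀ + r)) :=
      (isCompact_closedBall _ _).uniformContinuousOn_of_continuous (hfc.mono hρ₀Ω)
    rw [Metric.uniformContinuousOn_iff] at huc
    obtain ⟨ρ₁, hρ₁, huc⟩ := huc δ hδ
    let ρ := min ρ₀ ρ₁
    have hρ : 0 < ρ := lt_min hρ₀ hρ₁
    have hsub : closedBall x₀ (r + ρ) ⊆ closedBall x₀ (ρ₀ + r) :=
      closedBall_subset_closedBall (by linarith [min_le_left ρ₀ ρ₁])
    let η : ℝ → ℝ := fun s => max 0 (ρ - s)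
    have hηc : Continuous η := by fun_prop
    have hη_nonneg (s : ℝ) : 0 ≤ η s := le_max_left _ _
    have hη_le (s : ℝ) (hs : 0 ≤ s) : ‖η s‖ ≤ ρ := by
      rw [Real.norm_of_nonneg (hη_nonneg s)]
      exact max_le hρ.le (by linarith)
    have hη_zero (s : ℝ) (hs : ρ ≤ s) : η s = 0 := max_eq_left (by linarith)
    let w : EuclideanSpace ℝ (Fin N) → ℝ := fun y => ∫ x, η (dist x y) ∂μ
    have hwc : Continuous w := by
      refine continuous_of_dominated (bound := fun _ => ρ) (fun y => ?_) (fun y => ?_)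
        (integrable_const _) (Filter.Eventually.of_forall fun x => by fun_prop)
      · exact Continuous.aestronglyMeasurable (by fun_prop)
      · exact Filter.Eventually.of_forall fun x => hη_le _ dist_nonneg
    let e : EuclideanSpace ℝ (Fin N) := EuclideanSpace.single ⟨0, hN⟩ 1
    let h : ℝ → ℝ := fun t => w (x₀ + √t • e)
    have hhc : Continuous h := by fun_prop
    have hhw (y : EuclideanSpace ℝ (Fin N)) : h (‖y - x₀‖ ^ 2) = w y := by
      refine setIntegral_sphere_dist_eq _ η r ?_
      simp [e, norm_smul, Real.sqrt_sq]
    have hw0 (y : EuclideanSpace ℝ (Fin N)) (hy : r + ρ ≤ ‖y - x₀‖) : w y = 0 := by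
      refine setIntegral_eq_zero_of_forall_eq_zero fun x hx => hη_zero _ ?_
      rw [mem_sphere] at hx
      have := dist_triangle_left y x₀ x
      rw [← dist_eq_norm] at hy
      linarith
    have hh0 (t : ℝ) (ht : (r + ρ) ^ 2 ≤ t) : h t = 0 := by
      refine hw0 _ ?_
      simpa [e, norm_smul, abs_of_nonneg (Real.sqrt_nonneg t)] using Real.le_sqrt_of_sq_le ht
    have hzero := integral_radial_mul_flux_eq_zero hΩ hF hdiv (by positivity : 0 ≤ r + ρ)
      (hsub.trans hρ₀Ω) hhc hh0
    simp_rw [hhw] at hzero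
    let B := closedBall x₀ (r + ρ)
    have hzeroB : ∫ y in B, w y * f y = 0 := by
      rw [← hzero]
      refine setIntegral_eq_integral_of_forall_compl_eq_zero fun y hy => ?_
      rw [hw0 y, zero_mul]
      rw [mem_closedBall_iff_norm, not_le] at hy
      exact hy.le
    have hfB : Integrable f (volume.restrict B) :=
      (hfc.mono (hsub.trans hρ₀Ω)).integrableOn_compact (isCompact_closedBall _ _)
    have hkint : Integrable (fun p : EuclideanSpace ℝ (Fin N) × EuclideanSpace ℝ (Fin N) =>
        η (dist p.1 p.2) * f p.2) (μ.prod (volume.restrict B)) :=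
      (hfB.comp_snd μ).bdd_mul (c := ρ) (Continuous.aestronglyMeasurable (by fun_prop))
        (Filter.Eventually.of_forall fun p => hη_le _ dist_nonneg)
    have hswap : ∫ x, (∫ y in B, η (dist x y) * f y) ∂μ = 0 := by
      rw [integral_integral_swap hkint, ← hzeroB]
      refine integral_congr_ae (Filter.Eventually.of_forall fun y => ?_)
      exact integral_mul_const _ _
    let K : ℝ := ∫ z : EuclideanSpace ℝ (Fin N), η ‖z‖
    have hηint (x : EuclideanSpace ℝ (Fin N)) : Integrable fun y => η (dist x y) := by
      refine Continuous.integrable_of_hasCompactSupport (by fun_prop)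
        (HasCompactSupport.intro (isCompact_closedBall x ρ) fun y hy => hη_zero _ ?_)
      rw [mem_closedBall', not_le] at hy
      exact hy.le
    have hK : 0 < K := by
      refine Continuous.integral_pos_of_hasCompactSupport_nonneg_nonzero (x := 0)
        (by fun_prop) ?_ (fun z => hη_nonneg _) ?_
      · refine HasCompactSupport.intro (isCompact_closedBall 0 ρ) fun y hy => hη_zero _ ?_
        rw [mem_closedBall_zero_iff, not_le] at hy
        exact hy.le
      · simp [η, hρ.le, hρ.ne']
    have hxB (x : EuclideanSpace ℝ (Fin N)) (hx : x ∈ sphere x₀ r) (y : EuclideanSpace ℝ (Fin N))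
        (hy : y ∉ B) : η (dist x y) = 0 := by
      apply hη_zero
      rw [mem_closedBall, not_le] at hy
      rw [mem_sphere] at hx
      linarith [dist_triangle_left y x₀ x]
    have hKx (x : EuclideanSpace ℝ (Fin N)) (hx : x ∈ sphere x₀ r) :
        ∫ y in B, η (dist x y) = K := by
      rw [setIntegral_eq_integral_of_forall_compl_eq_zero (hxB x hx)]
      simp_rw [dist_eq_norm]
      exact integral_sub_left_eq_self (fun z : EuclideanSpace ℝ (Fin N) => η ‖z‖) volume x
    have hpt (x : EuclideanSpace ℝ (Fin N)) (hx : x ∈ sphere x₀ r) :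
        ‖K * f x - ∫ y in B, η (dist x y) * f y‖ ≤ δ * K := by
      have hinteg : Integrable (fun y => η (dist x y) * f y) (volume.restrict B) :=
        hfB.bdd_mul (c := ρ) (Continuous.aestronglyMeasurable (by fun_prop))
          (Filter.Eventually.of_forall fun y => hη_le _ dist_nonneg)
      rw [← hKx x hx, ← integral_mul_const, ← integral_const_mul,
        ← integral_sub ((hηint x).integrableOn.mul_const _) hinteg]
      refine norm_integral_le_of_norm_le ((hηint x).integrableOn.const_mul δ) ?_
      refine (ae_restrict_iff' measurableSet_closedBall).2 (Filter.Eventually.of_forall ?_)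
      intro y hy
      rw [← mul_sub, norm_mul, Real.norm_of_nonneg (hη_nonneg _), mul_comm]
      by_cases hxy : dist x y < ρ
      · refine mul_le_mul_of_nonneg_right ?_ (hη_nonneg _)
        rw [← dist_eq_norm]
        refine (huc x (hsub ?_) y (hsub hy) (hxy.trans_le (min_le_right _ _))).le
        rw [mem_sphere] at hx
        rw [mem_closedBall]
        linarith
      · rw [hη_zero _ (not_lt.1 hxy)]
        simp
    have hfμ : Integrable f μ :=
      (hfc.mono (sphere_subset_closedBall.trans hball)).integrableOn_sphere_hausdorffMeasure hr
    have hbound : ‖∫ x, (K * f x - ∫ y in B, η (dist x y) * f y) ∂μ‖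
        ≤ δ * K * μ.real Set.univ := by
      refine norm_integral_le_of_norm_le_const ?_
      exact (ae_restrict_iff' isClosed_sphere.measurableSet).2 (Filter.Eventually.of_forall hpt)
    rw [integral_sub (hfμ.const_mul K) hkint.integral_prod_left, hswap, sub_zero,
      integral_const_mul, norm_mul, Real.norm_of_nonneg hK.le, Real.norm_eq_abs] at hbound
    refine le_of_mul_le_mul_left ?_ hK
    linarith
  have hlim : |∫ x, f x ∂μ| ≤ 0 := by
    refine le_of_forall_pos_le_add fun c hc => ?_
    have hm : 0 < μ.real Set.univ + 1 := by positivity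
    refine (hle (c / (μ.real Set.univ + 1)) (by positivity)).trans ?_
    rw [zero_add, div_mul_eq_mul_div, div_le_iff₀ hm]
    nlinarith
  exact abs_nonpos_iff.1 hlim

theorem gradient_apply_eq_fderiv_single {N : ℕ} (u : EuclideanSpace ℝ (Fin N) → ℝ)
    (x : EuclideanSpace ℝ (Fin N)) (k : Fin N) :
    gradient u x k = fderiv ℝ u x (EuclideanSpace.single k 1) := by
  have := inner_gradient_left (𝕜 := ℝ) (f := u) (x := x) (y := EuclideanSpace.single k 1)
  rw [EuclideanSpace.inner_single_right] at this
  simpa using this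

/-- Equality of mixed second derivatives. -/
theorem ContDiffAt.fderiv_fderiv_apply_comm {E : Type*} [NormedAddCommGroup E] [NormedSpace ℝ E]
    {u : E → ℝ} {x : E} (hu : ContDiffAt ℝ 2 u x) (v w : E) :
    fderiv ℝ (fun y => fderiv ℝ u y v) x w = fderiv ℝ (fun y => fderiv ℝ u y w) x v := by
  have hd : DifferentiableAt ℝ (fderiv ℝ u) x :=
    (hu.fderiv_right (m := 1) (by norm_num)).differentiableAt one_ne_zero
  have happ (a b : E) : fderiv ℝ (fun y => fderiv ℝ u y a) x b
      = fderiv ℝ (fderiv ℝ u) x b a := by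
    rw [(hd.hasFDerivAt.clm_apply (hasFDerivAt_const a x)).fderiv]
    simp
  rw [happ, happ]
  exact hu.isSymmSndFDerivAt (by simp) _ _

/-- The `j`-th component of the field `-∂ᵢu ∇u + (|∇u|² / 2 - G) eᵢ`. -/
noncomputable def stressField {N : ℕ} (u G : EuclideanSpace ℝ (Fin N) → ℝ) (i j : Fin N)
    (x : EuclideanSpace ℝ (Fin N)) : ℝ :=
  -(fderiv ℝ u x (EuclideanSpace.single j 1) * fderiv ℝ u x (EuclideanSpace.single i 1))
    + (if j = i then 1 else 0) *
      (1 / 2 * ∑ k, fderiv ℝ u x (EuclideanSpace.single k 1) ^ 2 - G x)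

theorem contDiffOn_stressField {N : ℕ} {Ω : Set (EuclideanSpace ℝ (Fin N))} (hΩ : IsOpen Ω)
    {u G : EuclideanSpace ℝ (Fin N) → ℝ} (hu : ContDiffOn ℝ 2 u Ω) (hG : ContDiffOn ℝ 1 G Ω)
    (i j : Fin N) : ContDiffOn ℝ 1 (stressField u G i j) Ω := by
  have hD (k : Fin N) :
      ContDiffOn ℝ 1 (fun x => fderiv ℝ u x (EuclideanSpace.single k 1)) Ω :=
    (hu.fderiv_of_isOpen hΩ (by norm_num)).clm_apply contDiffOn_const
  exact ((hD j).mul (hD i)).neg.add (contDiffOn_const.mul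
    ((contDiffOn_const.mul (ContDiffOn.sum fun k _ => (hD k).pow 2)).sub hG))

/-- The divergence of `-∂ᵢu ∇u + (|∇u|² / 2 - G) eᵢ` is `-Δu ∂ᵢu - ∂ᵢG`. -/
theorem divergence_stressField {N : ℕ} {u G : EuclideanSpace ℝ (Fin N) → ℝ}
    {x : EuclideanSpace ℝ (Fin N)} (hu : ContDiffAt ℝ 2 u x) (hG : DifferentiableAt ℝ G x)
    (i : Fin N) :
    ∑ j, fderiv ℝ (stressField u G i j) x (EuclideanSpace.single j 1)
      = -laplacian u x * fderiv ℝ u x (EuclideanSpace.single i 1)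
        - fderiv ℝ G x (EuclideanSpace.single i 1) := by
  let D : Fin N → EuclideanSpace ℝ (Fin N) → ℝ :=
    fun k x => fderiv ℝ u x (EuclideanSpace.single k 1)
  have hD (k : Fin N) : DifferentiableAt ℝ (D k) x :=
    ((hu.fderiv_right (m := 1) (by norm_num)).clm_apply contDiffAt_const).differentiableAt
      one_ne_zero
  have hsymm (j k : Fin N) : fderiv ℝ (D j) x (EuclideanSpace.single k 1)
      = fderiv ℝ (D k) x (EuclideanSpace.single j 1) := hu.fderiv_fderiv_apply_comm _ _
  have hsq : HasFDerivAt (fun x => ∑ k, D k x ^ 2) _ x :=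
    HasFDerivAt.fun_sum fun k _ => (hD k).hasFDerivAt.pow 2
  have hterm (j : Fin N) : fderiv ℝ (stressField u G i j) x (EuclideanSpace.single j 1)
      = -(D j x * fderiv ℝ (D j) x (EuclideanSpace.single i 1))
        - fderiv ℝ (D j) x (EuclideanSpace.single j 1) * D i x
        + if j = i then ∑ k, D k x * fderiv ℝ (D k) x (EuclideanSpace.single i 1)
          - fderiv ℝ G x (EuclideanSpace.single i 1) else 0 := by
    have h : HasFDerivAt (stressField u G i j) _ x :=
      ((hD j).hasFDerivAt.mul (hD i).hasFDerivAt).neg.add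
        (((hsq.const_mul (1 / 2)).sub hG.hasFDerivAt).const_mul (if j = i then 1 else 0))
    rw [h.fderiv, ← hsymm i j]
    by_cases hj : j = i
    · subst hj
      simp only [add_apply, neg_apply, smul_apply, sub_apply, sum_apply, smul_eq_mul, if_true,
        Finset.mul_sum]
      simp
      ring_nf
    · simp [hj]
      ring
  simp only [hterm, Finset.sum_add_distrib, Finset.sum_sub_distrib, Finset.sum_neg_distrib,
    Finset.sum_ite_eq', Finset.mem_univ, if_true, ← Finset.sum_mul]
  simp only [laplacian, D]
  ring

/-- The derivative of the primitive of the Brezis–Nirenberg nonlinearity along `u`. -/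
theorem fderiv_brezisNirenberg_primitive {E : Type*} [NormedAddCommGroup E] [NormedSpace ℝ E]
    {n : ℝ} (hn : 2 < n) (ε : ℝ) {u : E → ℝ} {x : E} (hu : DifferentiableAt ℝ u x)
    (hx : 0 < u x) (v : E) :
    fderiv ℝ (fun y => (n - 2) / (2 * n) * u y ^ (2 * n / (n - 2)) + ε / 2 * u y ^ 2) x v
      = (u x ^ ((n + 2) / (n - 2)) + ε * u x) * fderiv ℝ u x v := by
  have hn2 : n - 2 ≠ 0 := by linarith
  have hn0 : n ≠ 0 := by linarith
  have hexp : 2 * n / (n - 2) - 1 = (n + 2) / (n - 2) := by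
    field_simp
    ring
  rw [(((hu.hasFDerivAt.rpow_const (Or.inl hx.ne')).const_mul _).fun_add
    ((hu.hasFDerivAt.pow 2).const_mul _)).fderiv, hexp]
  simp only [add_apply, smul_apply, smul_eq_mul]
  field_simp
  simp
  ring

theorem integral_neg_add_const_mul_sub {α : Type*} [MeasurableSpace α] {μ : Measure α}
    {f₁ f₂ f₃ f₄ : α → ℝ} (h₁ : Integrable f₁ μ) (h₂ : Integrable f₂ μ) (h₃ : Integrable f₃ μ)
    (h₄ : Integrable f₄ μ) {a b c : ℝ} :
    ∫ x, (-f₁ x + a * f₂ x - (b * f₃ x + c * f₄ x)) ∂μ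
      = -(∫ x, f₁ x ∂μ) + a * ∫ x, f₂ x ∂μ - (b * ∫ x, f₃ x ∂μ + c * ∫ x, f₄ x ∂μ) := by
  rw [integral_sub (h₁.fun_neg.fun_add (h₂.const_mul a))
    ((h₃.const_mul b).fun_add (h₄.const_mul c)),
    integral_add h₁.fun_neg (h₂.const_mul a), integral_add (h₃.const_mul b) (h₄.const_mul c),
    integral_neg, integral_const_mul, integral_const_mul, integral_const_mul]

/-- First local Pohozaev identity for the Brezis–Nirenberg equation
`-Δu = u^{(N+2)/(N-2)} + ε u` on a ball contained in `Ω`.  The outward unit normal of the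
sphere `∂B_r(x₀)` is `ν(x) = (x - x₀)/r`, and boundary integrals are taken with respect to
the `(N-1)`-dimensional Hausdorff measure. -/
theorem pohozaev_identity_one {N : ℕ} (hN : 3 ≤ N)
    (Ω : Set (EuclideanSpace ℝ (Fin N))) (hΩ : IsOpen Ω) (ε : ℝ)
    (u : EuclideanSpace ℝ (Fin N) → ℝ)
    (hu : ContDiffOn ℝ 2 u Ω) (hupos : ∀ x ∈ Ω, 0 < u x)
    (hpde : ∀ x ∈ Ω, -laplacian u x = u x ^ (((N : ℝ) + 2) / ((N : ℝ) - 2)) + ε * u x)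
    (x₀ : EuclideanSpace ℝ (Fin N)) (r : ℝ) (hr : 0 < r)
    (hball : closedBall x₀ r ⊆ Ω) (i : Fin N) :
    -(∫ x in sphere x₀ r,
        (⟪gradient u x, r⁻¹ • (x - x₀)⟫) * fderiv ℝ u x (EuclideanSpace.single i 1)
          ∂μH[(N : ℝ) - 1])
      + (1 / 2) * ∫ x in sphere x₀ r,
          ‖gradient u x‖ ^ 2 * ((x - x₀) i / r) ∂μH[(N : ℝ) - 1]
    = (((N : ℝ) - 2) / (2 * (N : ℝ))) * ∫ x in sphere x₀ r,
          u x ^ ((2 * (N : ℝ)) / ((N : ℝ) - 2)) * ((x - x₀) i / r) ∂μH[(N : ℝ) - 1]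
      + (ε / 2) * ∫ x in sphere x₀ r, u x ^ 2 * ((x - x₀) i / r) ∂μH[(N : ℝ) - 1] := by
  have hN' : (2 : ℝ) < N := by exact_mod_cast hN
  let D : Fin N → EuclideanSpace ℝ (Fin N) → ℝ :=
    fun k x => fderiv ℝ u x (EuclideanSpace.single k 1)
  let G : EuclideanSpace ℝ (Fin N) → ℝ := fun x =>
    ((N : ℝ) - 2) / (2 * (N : ℝ)) * u x ^ ((2 * (N : ℝ)) / ((N : ℝ) - 2)) + ε / 2 * u x ^ 2
  have hD (k : Fin N) : ContinuousOn (D k) Ω :=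
    (hu.continuousOn_fderiv_of_isOpen hΩ (by norm_num)).clm_apply continuousOn_const
  have hu1 : ContDiffOn ℝ 1 u Ω := hu.of_le (by norm_num)
  have hpow : ContDiffOn ℝ 1 (fun x => u x ^ ((2 * (N : ℝ)) / ((N : ℝ) - 2))) Ω :=
    hu1.rpow_const_of_ne fun x hx => (hupos x hx).ne'
  have hG : ContDiffOn ℝ 1 G Ω :=
    (contDiffOn_const.mul hpow).add (contDiffOn_const.mul (hu1.pow 2))
  have hdiv (x : EuclideanSpace ℝ (Fin N)) (hx : x ∈ Ω) :
      ∑ j, fderiv ℝ (stressField u G i j) x (EuclideanSpace.single j 1) = 0 := by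
    have hxn := hΩ.mem_nhds hx
    rw [divergence_stressField (hu.contDiffAt hxn)
      ((hG.contDiffAt hxn).differentiableAt one_ne_zero), hpde x hx,
      fderiv_brezisNirenberg_primitive hN' ε
        ((hu1.contDiffAt hxn).differentiableAt one_ne_zero) (hupos x hx), sub_self]
  have hflux := setIntegral_sphere_flux_eq_zero (by omega) hΩ
    (contDiffOn_stressField hΩ hu hG i) hdiv hr hball
  have hnorm (x : EuclideanSpace ℝ (Fin N)) : ‖gradient u x‖ ^ 2 = ∑ k, D k x ^ 2 := by
    simp [EuclideanSpace.norm_sq_eq, gradient_apply_eq_fderiv_single, D]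
  have hinner (x : EuclideanSpace ℝ (Fin N)) :
      ⟪gradient u x, r⁻¹ • (x - x₀)⟫ = r⁻¹ * ∑ k, D k x * (x - x₀) k := by
    rw [inner_smul_right, PiLp.inner_apply]
    simp [gradient_apply_eq_fderiv_single, D, mul_comm]
  have hcoord (k : Fin N) :
      ContinuousOn (fun x : EuclideanSpace ℝ (Fin N) => (x - x₀) k) Ω := by fun_prop
  have hcoord_div := (hcoord i).div_const r
  have hinteg {f : EuclideanSpace ℝ (Fin N) → ℝ} (hf : ContinuousOn f Ω) :
      IntegrableOn f (sphere x₀ r) μH[(N : ℝ) - 1] :=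
    (hf.mono (sphere_subset_closedBall.trans hball)).integrableOn_sphere_hausdorffMeasure hr
  have hradial : ContinuousOn (fun x => ∑ k, D k x * (x - x₀) k) Ω :=
    continuousOn_finsetSum _ fun k _ => (hD k).mul (hcoord k)
  have hsq : ContinuousOn (fun x => ∑ k, D k x ^ 2) Ω :=
    continuousOn_finsetSum _ fun k _ => (hD k).pow 2
  have hint_flux := hinteg (f := fun x => (r⁻¹ * ∑ k, D k x * (x - x₀) k) * D i x)
    ((hradial.const_mul r⁻¹).mul (hD i))
  have hint_grad := hinteg (f := fun x => (∑ k, D k x ^ 2) * ((x - x₀) i / r))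
    (hsq.mul hcoord_div)
  have hint_rpow := hinteg (f := fun x => u x ^ ((2 * (N : ℝ)) / ((N : ℝ) - 2)) * ((x - x₀) i / r))
    (hpow.continuousOn.mul hcoord_div)
  have hint_sq := hinteg (f := fun x => u x ^ 2 * ((x - x₀) i / r))
    ((hu1.continuousOn.pow 2).mul hcoord_div)
  simp_rw [hinner, hnorm]
  change -(∫ x in sphere x₀ r, (r⁻¹ * ∑ k, D k x * (x - x₀) k) * D i x ∂μH[(N : ℝ) - 1]) + _ = _
  have hpoint (x : EuclideanSpace ℝ (Fin N)) : r⁻¹ * ∑ j, stressField u G i j x * (x - x₀) j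
      = -((r⁻¹ * ∑ k, D k x * (x - x₀) k) * D i x)
        + (1 / 2) * ((∑ k, D k x ^ 2) * ((x - x₀) i / r))
        - (((N : ℝ) - 2) / (2 * (N : ℝ)) *
            (u x ^ ((2 * (N : ℝ)) / ((N : ℝ) - 2)) * ((x - x₀) i / r))
          + ε / 2 * (u x ^ 2 * ((x - x₀) i / r))) := by
    have hflux_eq : ∑ j, stressField u G i j x * (x - x₀) j
        = -((∑ k, D k x * (x - x₀) k) * D i x)
          + (1 / 2 * ∑ k, D k x ^ 2 - G x) * (x - x₀) i := by
      simp only [stressField, add_mul, Finset.sum_add_distrib, ite_mul, one_mul, zero_mul,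
        Finset.sum_ite_eq', Finset.mem_univ, if_true, Finset.sum_mul, ← Finset.sum_neg_distrib]
      congr 1
      exact Finset.sum_congr rfl fun k _ => by ring
    rw [hflux_eq]
    simp only [G]
    ring
  have htotal : ∫ x in sphere x₀ r, r⁻¹ * ∑ j, stressField u G i j x * (x - x₀) j
      ∂μH[(N : ℝ) - 1] = 0 := by
    rw [integral_const_mul, hflux, mul_zero]
  rw [integral_congr_ae (Filter.Eventually.of_forall hpoint),
    integral_neg_add_const_mul_sub hint_flux hint_grad hint_rpow hint_sq] at htotal
  exact sub_eq_zero.1 htotal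
end

section
/- Let N ≥ 3 be an integer and let σ be a real number with 0 < σ < N−2. Then there exists a constant C > 0 such that for every y ∈ ℝ^N, ∫_{ℝ^N} |y−z|^{−(N−2)} (1+|z|)^{−(2+σ)} dz ≤ C (1+|y|)^{−σ}. -/
open MeasureTheory Real

section RadialPowers

open Set Module

variable {E : Type*} [NormedAddCommGroup E] [NormedSpace ℝ E] [FiniteDimensional ℝ E]
  [Nontrivial E]

/-- In polar coordinates, the density of `‖x‖ ^ (-p)` restricted to `‖x‖ ∈ S` is
`t ^ (finrank ℝ E - 1 - p)` on `S`. -/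
lemma pow_finrank_smul_indicator_rpow {S : Set ℝ} (p : ℝ) {t : ℝ} (ht : 0 < t) :
    t ^ (finrank ℝ E - 1) • S.indicator (fun s : ℝ => s ^ (-p)) t =
      S.indicator (fun s : ℝ => s ^ ((finrank ℝ E : ℝ) - 1 - p)) t := by
  by_cases h : t ∈ S
  · have hd : 1 ≤ finrank ℝ E := finrank_pos
    simp only [indicator_of_mem h, smul_eq_mul]
    rw [← rpow_natCast, ← rpow_add ht, Nat.cast_sub hd, Nat.cast_one, sub_eq_add_neg _ p]
  · simp [indicator_of_notMem h]

variable [MeasurableSpace E] [BorelSpace E] (μ : Measure E) [μ.IsAddHaarMeasure]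

lemma integrable_indicator_norm_rpow {S : Set ℝ} (hS : MeasurableSet S) {p : ℝ}
    (hint : IntegrableOn (fun t : ℝ => t ^ ((finrank ℝ E : ℝ) - 1 - p)) S) :
    Integrable (fun x : E => S.indicator (fun s : ℝ => s ^ (-p)) ‖x‖) μ := by
  rw [integrable_fun_norm_addHaar μ (f := S.indicator fun s : ℝ => s ^ (-p))]
  exact (hint.integrable_indicator hS).integrableOn.congr_fun
    (fun t ht => (pow_finrank_smul_indicator_rpow p ht).symm) measurableSet_Ioi

lemma integral_indicator_norm_rpow {S : Set ℝ} (hS : MeasurableSet S) (hS₀ : S ⊆ Ioi 0) (p : ℝ) :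
    ∫ x : E, S.indicator (fun s : ℝ => s ^ (-p)) ‖x‖ ∂μ =
      finrank ℝ E * μ.real (Metric.ball 0 1) *
        ∫ t in S, t ^ ((finrank ℝ E : ℝ) - 1 - p) := by
  rw [integral_fun_norm_addHaar μ (S.indicator fun s : ℝ => s ^ (-p)),
    setIntegral_congr_fun measurableSet_Ioi
      (fun t ht => pow_finrank_smul_indicator_rpow p ht),
    setIntegral_indicator hS, inter_eq_self_of_subset_right hS₀, nsmul_eq_mul, smul_eq_mul,
    mul_assoc]

lemma integrable_indicator_Ioc_norm_rpow {p R : ℝ} (hp : p < finrank ℝ E) (hR : 0 < R) :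
    Integrable (fun x : E => (Ioc 0 R).indicator (fun s : ℝ => s ^ (-p)) ‖x‖) μ := by
  refine integrable_indicator_norm_rpow μ measurableSet_Ioc ?_
  rw [← intervalIntegrable_iff_integrableOn_Ioc_of_le hR.le]
  exact intervalIntegral.intervalIntegrable_rpow' (by linarith)

lemma integral_indicator_Ioc_norm_rpow {p R : ℝ} (hp : p < finrank ℝ E) (hR : 0 < R) :
    ∫ x : E, (Ioc 0 R).indicator (fun s : ℝ => s ^ (-p)) ‖x‖ ∂μ =
      finrank ℝ E * μ.real (Metric.ball 0 1) *
        (R ^ ((finrank ℝ E : ℝ) - p) / (finrank ℝ E - p)) := by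
  rw [integral_indicator_norm_rpow μ measurableSet_Ioc (fun t ht => ht.1),
    ← intervalIntegral.integral_of_le hR.le, integral_rpow (Or.inl (by linarith))]
  have he : (finrank ℝ E : ℝ) - 1 - p + 1 = finrank ℝ E - p := by ring
  rw [he, zero_rpow (by linarith), sub_zero]

lemma integrable_indicator_Ioi_norm_rpow {p R : ℝ} (hp : finrank ℝ E < p) (hR : 0 < R) :
    Integrable (fun x : E => (Ioi R).indicator (fun s : ℝ => s ^ (-p)) ‖x‖) μ :=
  integrable_indicator_norm_rpow μ measurableSet_Ioi
    (integrableOn_Ioi_rpow_of_lt (by linarith) hR)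

lemma integral_indicator_Ioi_norm_rpow {p R : ℝ} (hp : finrank ℝ E < p) (hR : 0 < R) :
    ∫ x : E, (Ioi R).indicator (fun s : ℝ => s ^ (-p)) ‖x‖ ∂μ =
      finrank ℝ E * μ.real (Metric.ball 0 1) *
        (R ^ ((finrank ℝ E : ℝ) - p) / (p - finrank ℝ E)) := by
  rw [integral_indicator_norm_rpow μ measurableSet_Ioi (Ioi_subset_Ioi hR.le),
    integral_Ioi_rpow_of_lt (by linarith) hR]
  have he : (finrank ℝ E : ℝ) - 1 - p + 1 = finrank ℝ E - p := by ring
  rw [he, neg_div, ← div_neg, neg_sub]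

end RadialPowers

open Set in
/-- Pointwise bound behind the convolution estimate: with `a = |y - z|`, `b = |z|`, `R = 1 + |y|`,
the kernel is controlled by its behaviour near `y`, for moderate `z`, and near infinity. -/
lemma rpow_mul_one_add_rpow_le_indicators {a b R α β : ℝ} (ha : 0 ≤ a) (hb : 0 < b) (hR : 0 < R)
    (hα : 0 < α) (hβ : 0 ≤ β) (hRab : R ≤ a + (1 + b)) (hbRa : b ≤ R + a) :
    a ^ (-α) * (1 + b) ^ (-β) ≤
      (R / 2) ^ (-β) * (Ioc 0 (R / 2)).indicator (fun s : ℝ => s ^ (-α)) a +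
      (R / 2) ^ (-α) * (Ioc 0 R).indicator (fun s : ℝ => s ^ (-β)) b +
      3 ^ α * (Ioi R).indicator (fun s : ℝ => s ^ (-(α + β))) b := by
  have hnonneg (S : Set ℝ) (γ : ℝ) {t : ℝ} (ht : 0 ≤ t) :
      0 ≤ S.indicator (fun s : ℝ => s ^ γ) t :=
    indicator_apply_nonneg fun _ => rpow_nonneg ht γ
  have h₁ : 0 ≤ (R / 2) ^ (-β) * (Ioc 0 (R / 2)).indicator (fun s : ℝ => s ^ (-α)) a :=
    mul_nonneg (by positivity) (hnonneg _ _ ha)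
  have h₂ : 0 ≤ (R / 2) ^ (-α) * (Ioc 0 R).indicator (fun s : ℝ => s ^ (-β)) b :=
    mul_nonneg (by positivity) (hnonneg _ _ hb.le)
  have h₃ : 0 ≤ 3 ^ α * (Ioi R).indicator (fun s : ℝ => s ^ (-(α + β))) b :=
    mul_nonneg (by positivity) (hnonneg _ _ hb.le)
  have hb_le : (1 + b) ^ (-β) ≤ b ^ (-β) :=
    rpow_le_rpow_of_nonpos hb (by linarith) (by linarith)
  rcases ha.eq_or_lt with rfl | ha'
  · rw [zero_rpow (by linarith), zero_mul]
    positivity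
  rcases le_or_gt a (R / 2) with haR | haR
  · have hle : a ^ (-α) * (1 + b) ^ (-β) ≤ a ^ (-α) * (R / 2) ^ (-β) :=
      mul_le_mul_of_nonneg_left
        (rpow_le_rpow_of_nonpos (by positivity) (by linarith) (by linarith)) (by positivity)
    have hmem : a ∈ Ioc 0 (R / 2) := ⟨ha', haR⟩
    rw [indicator_of_mem hmem] at h₁ ⊢
    linarith [mul_comm (a ^ (-α)) ((R / 2) ^ (-β))]
  rcases le_or_gt b R with hbR | hbR
  · have hle : a ^ (-α) * (1 + b) ^ (-β) ≤ (R / 2) ^ (-α) * b ^ (-β) :=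
      mul_le_mul (rpow_le_rpow_of_nonpos (by positivity) haR.le (by linarith)) hb_le
        (by positivity) (by positivity)
    have hmem : b ∈ Ioc 0 R := ⟨hb, hbR⟩
    rw [indicator_of_mem hmem] at h₂ ⊢
    linarith
  · have hle : a ^ (-α) * (1 + b) ^ (-β) ≤ (b / 3) ^ (-α) * b ^ (-β) :=
      mul_le_mul (rpow_le_rpow_of_nonpos (by positivity) (by linarith) (by linarith)) hb_le
        (by positivity) (by positivity)
    have heq : (b / 3) ^ (-α) * b ^ (-β) = 3 ^ α * b ^ (-(α + β)) := by
      rw [div_rpow hb.le (by norm_num), rpow_neg (by norm_num : (0 : ℝ) ≤ 3), neg_add,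
        rpow_add hb, div_inv_eq_mul]
      ring
    have hmem : b ∈ Ioi R := hbR
    rw [indicator_of_mem hmem] at h₃ ⊢
    linarith

/-- Convolution estimate (Lemma B.2-type estimate, subcritical case): for `0 < σ < N - 2`
there is a constant `C > 0` such that for every `y ∈ ℝ^N`,
`∫_{ℝ^N} |y - z|^{-(N-2)} (1 + |z|)^{-(2+σ)} dz ≤ C (1 + |y|)^{-σ}`.
(In particular the integral is finite for every `y`.) -/
theorem convolution_estimate_subcritical {N : ℕ} (hN : 3 ≤ N) (σ : ℝ)
    (hσ₀ : 0 < σ) (hσ : σ < (N : ℝ) - 2) :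
    ∃ C : ℝ, 0 < C ∧ ∀ y : EuclideanSpace ℝ (Fin N),
      Integrable (fun z : EuclideanSpace ℝ (Fin N) =>
        ‖y - z‖ ^ (-((N : ℝ) - 2)) * (1 + ‖z‖) ^ (-(2 + σ))) ∧
      (∫ z : EuclideanSpace ℝ (Fin N),
          ‖y - z‖ ^ (-((N : ℝ) - 2)) * (1 + ‖z‖) ^ (-(2 + σ)))
        ≤ C * (1 + ‖y‖) ^ (-σ) := by
  have hdim : Module.finrank ℝ (EuclideanSpace ℝ (Fin N)) = N := finrank_euclideanSpace_fin
  have hN' : (3 : ℝ) ≤ N := by exact_mod_cast hN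
  have : Nontrivial (EuclideanSpace ℝ (Fin N)) :=
    Module.nontrivial_of_finrank_pos (R := ℝ) (by omega)
  set V : ℝ := N * (volume : Measure (EuclideanSpace ℝ (Fin N))).real (Metric.ball 0 1)
  have hV₀ : 0 ≤ V := by positivity
  have hd : 0 < (N : ℝ) - (2 + σ) := by linarith
  refine ⟨V * (2 ^ σ / 2 + 2 ^ ((N : ℝ) - 2) / (N - (2 + σ)) + 3 ^ ((N : ℝ) - 2) / σ) + 1,
    by positivity, fun y => ?_⟩
  set R : ℝ := 1 + ‖y‖
  have hR₀ : 0 < R := by positivity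
  set near := fun z : EuclideanSpace ℝ (Fin N) =>
    (Set.Ioc 0 (R / 2)).indicator (fun s : ℝ => s ^ (-((N : ℝ) - 2))) ‖z‖
  set mid := fun z : EuclideanSpace ℝ (Fin N) =>
    (Set.Ioc 0 R).indicator (fun s : ℝ => s ^ (-(2 + σ))) ‖z‖
  set far := fun z : EuclideanSpace ℝ (Fin N) =>
    (Set.Ioi R).indicator (fun s : ℝ => s ^ (-((N : ℝ) - 2 + (2 + σ)))) ‖z‖
  have hnear : Integrable near :=
    integrable_indicator_Ioc_norm_rpow volume (by rw [hdim]; linarith) (by positivity)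
  have hmid : Integrable mid :=
    integrable_indicator_Ioc_norm_rpow volume (by rw [hdim]; linarith) hR₀
  have hfar : Integrable far :=
    integrable_indicator_Ioi_norm_rpow volume (by rw [hdim]; linarith) hR₀
  have hnear_y : Integrable (fun z => near (y - z)) := hnear.comp_sub_left y
  have hbound : ∀ᵐ z : EuclideanSpace ℝ (Fin N),
      ‖y - z‖ ^ (-((N : ℝ) - 2)) * (1 + ‖z‖) ^ (-(2 + σ)) ≤
        (R / 2) ^ (-(2 + σ)) * near (y - z) + (R / 2) ^ (-((N : ℝ) - 2)) * mid z +
          3 ^ ((N : ℝ) - 2) * far z := by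
    filter_upwards [Measure.ae_ne volume 0] with z hz
    refine rpow_mul_one_add_rpow_le_indicators (norm_nonneg _) (norm_pos_iff.mpr hz) hR₀
      (by linarith) (by linarith) ?_ ?_
    · have := norm_le_norm_sub_add y z
      linarith
    · have := norm_le_norm_add_norm_sub y z
      linarith
  have hnear_mid : Integrable (fun z => (R / 2) ^ (-(2 + σ)) * near (y - z) +
      (R / 2) ^ (-((N : ℝ) - 2)) * mid z) := (hnear_y.const_mul _).add (hmid.const_mul _)
  have hdom : Integrable (fun z => (R / 2) ^ (-(2 + σ)) * near (y - z) +
      (R / 2) ^ (-((N : ℝ) - 2)) * mid z + 3 ^ ((N : ℝ) - 2) * far z) :=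
    hnear_mid.add (hfar.const_mul _)
  have hint : Integrable (fun z : EuclideanSpace ℝ (Fin N) =>
      ‖y - z‖ ^ (-((N : ℝ) - 2)) * (1 + ‖z‖) ^ (-(2 + σ))) := by
    refine hdom.mono' (by fun_prop) ?_
    filter_upwards [hbound] with z hz
    rwa [norm_of_nonneg (by positivity)]
  have hnear_eq : ∫ z, near (y - z) = V * ((R / 2) ^ (2 : ℝ) / 2) := by
    rw [integral_sub_left_eq_self near volume y,
      integral_indicator_Ioc_norm_rpow volume (by rw [hdim]; linarith) (by positivity), hdim,
      sub_sub_cancel]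
  have hmid_eq : ∫ z, mid z = V * (R ^ ((N : ℝ) - (2 + σ)) / (N - (2 + σ))) := by
    rw [integral_indicator_Ioc_norm_rpow volume (by rw [hdim]; linarith) hR₀, hdim]
  have hfar_eq : ∫ z, far z = V * (R ^ (-σ) / σ) := by
    rw [integral_indicator_Ioi_norm_rpow volume (by rw [hdim]; linarith) hR₀, hdim,
      show (N : ℝ) - (N - 2 + (2 + σ)) = -σ by ring, show (N : ℝ) - 2 + (2 + σ) - N = σ by ring]
  have hnear_pow : (R / 2) ^ (-(2 + σ)) * (R / 2) ^ (2 : ℝ) = 2 ^ σ * R ^ (-σ) := by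
    rw [← rpow_add (by positivity), show -(2 + σ) + 2 = -σ by ring, div_rpow hR₀.le (by norm_num),
      rpow_neg (by norm_num : (0 : ℝ) ≤ 2), div_inv_eq_mul, mul_comm]
  have hmid_pow : (R / 2) ^ (-((N : ℝ) - 2)) * R ^ ((N : ℝ) - (2 + σ)) =
      2 ^ ((N : ℝ) - 2) * R ^ (-σ) := by
    rw [div_rpow hR₀.le (by norm_num), rpow_neg (by norm_num : (0 : ℝ) ≤ 2), div_inv_eq_mul,
      mul_right_comm, ← rpow_add hR₀, mul_comm]
    ring_nf
  refine ⟨hint, ?_⟩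
  calc ∫ z : EuclideanSpace ℝ (Fin N), ‖y - z‖ ^ (-((N : ℝ) - 2)) * (1 + ‖z‖) ^ (-(2 + σ))
      ≤ ∫ z, ((R / 2) ^ (-(2 + σ)) * near (y - z) + (R / 2) ^ (-((N : ℝ) - 2)) * mid z +
          3 ^ ((N : ℝ) - 2) * far z) := integral_mono_ae hint hdom hbound
    _ = (R / 2) ^ (-(2 + σ)) * (V * ((R / 2) ^ (2 : ℝ) / 2)) +
        (R / 2) ^ (-((N : ℝ) - 2)) * (V * (R ^ ((N : ℝ) - (2 + σ)) / (N - (2 + σ)))) +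
        3 ^ ((N : ℝ) - 2) * (V * (R ^ (-σ) / σ)) := by
      rw [integral_add hnear_mid (hfar.const_mul _),
        integral_add (hnear_y.const_mul _) (hmid.const_mul _), integral_const_mul,
        integral_const_mul, integral_const_mul, hnear_eq, hmid_eq, hfar_eq]
    _ = V * (((R / 2) ^ (-(2 + σ)) * (R / 2) ^ (2 : ℝ)) / 2 +
        ((R / 2) ^ (-((N : ℝ) - 2)) * R ^ ((N : ℝ) - (2 + σ))) / (N - (2 + σ)) +
        3 ^ ((N : ℝ) - 2) * R ^ (-σ) / σ) := by ring
    _ = V * (2 ^ σ / 2 + 2 ^ ((N : ℝ) - 2) / (N - (2 + σ)) + 3 ^ ((N : ℝ) - 2) / σ) *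
        R ^ (-σ) := by
      rw [hnear_pow, hmid_pow]
      ring
    _ ≤ _ := mul_le_mul_of_nonneg_right (by linarith) (by positivity)
end

section
/- Let N ≥ 3 be an integer. Then there exists a constant C > 0 such that for every y ∈ ℝ^N, ∫_{ℝ^N} |y−z|^{−(N−2)} (1+|z|)^{−(2+(N−2))} dz ≤ C · log(2+|y|) · (1+|y|)^{−(N−2)}. -/
open MeasureTheory Real

/-- A radial function on `ℝ^N` whose polar-coordinate density is dominated by an integrable `h`
is integrable, with integral at most the area of the sphere times the integral of `h`. -/
lemma integrable_radial_and_integral_le {N : ℕ} (hN : 0 < N) {f h : ℝ → ℝ} (hf : Measurable f)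
    (hf0 : ∀ r, 0 < r → 0 ≤ f r) (hle : ∀ r, 0 < r → r ^ (N - 1) * f r ≤ h r)
    (hh : IntegrableOn h (Set.Ioi 0)) :
    Integrable (fun z : EuclideanSpace ℝ (Fin N) => f ‖z‖) ∧
      ∫ z : EuclideanSpace ℝ (Fin N), f ‖z‖ ≤
        N * volume.real (Metric.ball (0 : EuclideanSpace ℝ (Fin N)) 1) *
          ∫ r in Set.Ioi 0, h r := by
  have : Nonempty (Fin N) := ⟨⟨0, hN⟩⟩
  have hint : IntegrableOn (fun r : ℝ => r ^ (N - 1) • f r) (Set.Ioi 0) := by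
    refine Integrable.mono' hh (by fun_prop) ?_
    filter_upwards [ae_restrict_mem measurableSet_Ioi] with r (hr : 0 < r)
    have := hf0 r hr
    rw [Real.norm_of_nonneg (by positivity)]
    exact hle r hr
  constructor
  · rw [integrable_fun_norm_addHaar]
    simpa using hint
  · rw [integral_fun_norm_addHaar]
    simp only [finrank_euclideanSpace, Fintype.card_fin, nsmul_eq_mul, smul_eq_mul, mul_assoc]
    gcongr ?_ * (?_ * ?_)
    exact setIntegral_mono_on hint hh measurableSet_Ioi fun r hr => hle r hr

lemma pow_pred_mul_rpow {N : ℕ} (hN : 0 < N) {r : ℝ} (hr : 0 < r) (s : ℝ) :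
    r ^ (N - 1) * r ^ s = r ^ ((N : ℝ) - 1 + s) := by
  rw [rpow_add hr, ← Nat.cast_pred hN, rpow_natCast]

lemma radial_estimate_near {N : ℕ} (hN : 3 ≤ N) {R : ℝ} (hR : 0 ≤ R) :
    Integrable (fun z : EuclideanSpace ℝ (Fin N) =>
      (Set.Iic R).indicator (fun r : ℝ => r ^ (-((N : ℝ) - 2))) ‖z‖) ∧
      ∫ z : EuclideanSpace ℝ (Fin N),
        (Set.Iic R).indicator (fun r : ℝ => r ^ (-((N : ℝ) - 2))) ‖z‖ ≤
        N * volume.real (Metric.ball (0 : EuclideanSpace ℝ (Fin N)) 1) * (R ^ 2 / 2) := by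
  have hval : ∫ r in Set.Ioi 0, (Set.Iic R).indicator (fun r : ℝ => r) r = R ^ 2 / 2 := by
    rw [setIntegral_indicator measurableSet_Iic, Set.Ioi_inter_Iic,
      ← intervalIntegral.integral_of_le hR, integral_id]
    ring
  rw [← hval]
  refine integrable_radial_and_integral_le (by lia)
    (Measurable.indicator (by fun_prop) measurableSet_Iic) ?_ ?_ ?_
  · intro r hr
    exact Set.indicator_apply_nonneg fun _ => by positivity
  · intro r hr
    by_cases h : r ∈ Set.Iic R
    · simp only [Set.indicator_of_mem h]
      rw [pow_pred_mul_rpow (by lia) hr]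
      ring_nf
      simp
    · simp [Set.indicator_of_notMem h]
  · rw [IntegrableOn, integrable_indicator_iff measurableSet_Iic, IntegrableOn,
      Measure.restrict_restrict measurableSet_Iic, Set.inter_comm, Set.Ioi_inter_Iic]
    exact (intervalIntegrable_iff_integrableOn_Ioc_of_le hR).1
      (continuous_id.intervalIntegrable 0 R)

lemma radial_estimate_middle {N : ℕ} (hN : 3 ≤ N) {R : ℝ} (hR : 0 ≤ R) :
    Integrable (fun z : EuclideanSpace ℝ (Fin N) =>
      (Set.Iic R).indicator (fun r : ℝ => (1 + r) ^ (-(N : ℝ))) ‖z‖) ∧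
      ∫ z : EuclideanSpace ℝ (Fin N),
        (Set.Iic R).indicator (fun r : ℝ => (1 + r) ^ (-(N : ℝ))) ‖z‖ ≤
        N * volume.real (Metric.ball (0 : EuclideanSpace ℝ (Fin N)) 1) * log (1 + R) := by
  have hval : ∫ r in Set.Ioi 0, (Set.Iic R).indicator (fun r : ℝ => (1 + r)⁻¹) r
      = log (1 + R) := by
    rw [setIntegral_indicator measurableSet_Iic, Set.Ioi_inter_Iic,
      ← intervalIntegral.integral_of_le hR,
      intervalIntegral.integral_comp_add_left (fun r : ℝ => r⁻¹),
      integral_inv_of_pos (by norm_num) (by positivity)]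
    simp
  rw [← hval]
  refine integrable_radial_and_integral_le (by lia)
    (Measurable.indicator (by fun_prop) measurableSet_Iic) ?_ ?_ ?_
  · intro r hr
    exact Set.indicator_apply_nonneg fun _ => by positivity
  · intro r hr
    by_cases h : r ∈ Set.Iic R
    · simp only [Set.indicator_of_mem h]
      calc r ^ (N - 1) * (1 + r) ^ (-(N : ℝ))
          ≤ (1 + r) ^ (N - 1) * (1 + r) ^ (-(N : ℝ)) := by gcongr; linarith
        _ = (1 + r)⁻¹ := by
          rw [pow_pred_mul_rpow (by lia) (by positivity), ← rpow_neg_one]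
          ring_nf
    · simp [Set.indicator_of_notMem h]
  · rw [IntegrableOn, integrable_indicator_iff measurableSet_Iic, IntegrableOn,
      Measure.restrict_restrict measurableSet_Iic, Set.inter_comm, Set.Ioi_inter_Iic]
    refine (intervalIntegrable_iff_integrableOn_Ioc_of_le hR).1
      (ContinuousOn.intervalIntegrable ?_)
    rw [Set.uIcc_of_le hR]
    refine ContinuousOn.inv₀ (by fun_prop) fun r hr => ?_
    have := hr.1
    positivity

lemma radial_estimate_far {N : ℕ} (hN : 3 ≤ N) {R : ℝ} (hR : 0 < R) :
    Integrable (fun z : EuclideanSpace ℝ (Fin N) =>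
      (Set.Ioi R).indicator (fun r : ℝ => r ^ (-((N : ℝ) - 2) - N)) ‖z‖) ∧
      ∫ z : EuclideanSpace ℝ (Fin N),
        (Set.Ioi R).indicator (fun r : ℝ => r ^ (-((N : ℝ) - 2) - N)) ‖z‖ ≤
        N * volume.real (Metric.ball (0 : EuclideanSpace ℝ (Fin N)) 1) *
          (R ^ (-((N : ℝ) - 2)) / ((N : ℝ) - 2)) := by
  have hN' : (3 : ℝ) ≤ N := by exact_mod_cast hN
  have hsub : Set.Ioi (0 : ℝ) ∩ Set.Ioi R = Set.Ioi R :=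
    Set.inter_eq_right.2 (Set.Ioi_subset_Ioi hR.le)
  have hval : ∫ r in Set.Ioi 0, (Set.Ioi R).indicator (fun r : ℝ => r ^ (1 - (N : ℝ))) r
      = R ^ (-((N : ℝ) - 2)) / ((N : ℝ) - 2) := by
    rw [setIntegral_indicator measurableSet_Ioi, hsub, integral_Ioi_rpow_of_lt (by linarith) hR,
      show 1 - (N : ℝ) + 1 = -((N : ℝ) - 2) by ring, neg_div_neg_eq]
  rw [← hval]
  refine integrable_radial_and_integral_le (by lia)
    (Measurable.indicator (by fun_prop) measurableSet_Ioi) ?_ ?_ ?_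
  · intro r hr
    exact Set.indicator_apply_nonneg fun _ => by positivity
  · intro r hr
    by_cases h : r ∈ Set.Ioi R
    · simp only [Set.indicator_of_mem h]
      rw [pow_pred_mul_rpow (by lia) hr]
      ring_nf
      simp
    · simp [Set.indicator_of_notMem h]
  · rw [IntegrableOn, integrable_indicator_iff measurableSet_Ioi, IntegrableOn,
      Measure.restrict_restrict measurableSet_Ioi, Set.inter_comm, hsub]
    exact integrableOn_Ioi_rpow_of_lt (by linarith) hR

/-- Splitting of the kernel into the regions `|y - z| ≤ R / 2`, `|z| ≤ 2 R` and `|z| > 2 R`,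
where `R = 1 + |y|`. -/
lemma kernel_le_sum_radial {N : ℕ} (hN : 3 ≤ N) (y z : EuclideanSpace ℝ (Fin N)) :
    ‖y - z‖ ^ (-((N : ℝ) - 2)) * (1 + ‖z‖) ^ (-(N : ℝ)) ≤
      ((1 + ‖y‖) / 2) ^ (-(N : ℝ)) *
          (Set.Iic ((1 + ‖y‖) / 2)).indicator (fun r : ℝ => r ^ (-((N : ℝ) - 2))) ‖y - z‖ +
        ((1 + ‖y‖) / 2) ^ (-((N : ℝ) - 2)) *
          (Set.Iic (2 * (1 + ‖y‖))).indicator (fun r : ℝ => (1 + r) ^ (-(N : ℝ))) ‖z‖ +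
        (1 / 2) ^ (-((N : ℝ) - 2)) *
          (Set.Ioi (2 * (1 + ‖y‖))).indicator (fun r : ℝ => r ^ (-((N : ℝ) - 2) - N)) ‖z‖ := by
  have hN' : (3 : ℝ) ≤ N := by exact_mod_cast hN
  have hy := norm_nonneg y
  have hz := norm_nonneg z
  have hyz := norm_nonneg (y - z)
  have htri : ‖y‖ ≤ ‖y - z‖ + ‖z‖ := by simpa using norm_add_le (y - z) z
  have htri' : ‖z‖ ≤ ‖y - z‖ + ‖y‖ := by
    rw [norm_sub_rev]; simpa using norm_add_le (z - y) y
  have h₁ : 0 ≤ ((1 + ‖y‖) / 2) ^ (-(N : ℝ)) *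
      (Set.Iic ((1 + ‖y‖) / 2)).indicator (fun r : ℝ => r ^ (-((N : ℝ) - 2))) ‖y - z‖ :=
    mul_nonneg (by positivity) (Set.indicator_apply_nonneg fun _ => by positivity)
  have h₂ : 0 ≤ ((1 + ‖y‖) / 2) ^ (-((N : ℝ) - 2)) *
      (Set.Iic (2 * (1 + ‖y‖))).indicator (fun r : ℝ => (1 + r) ^ (-(N : ℝ))) ‖z‖ :=
    mul_nonneg (by positivity) (Set.indicator_apply_nonneg fun _ => by positivity)
  have h₃ : 0 ≤ (1 / 2 : ℝ) ^ (-((N : ℝ) - 2)) *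
      (Set.Ioi (2 * (1 + ‖y‖))).indicator (fun r : ℝ => r ^ (-((N : ℝ) - 2) - N)) ‖z‖ :=
    mul_nonneg (by positivity) (Set.indicator_apply_nonneg fun _ => by positivity)
  rcases le_or_gt ‖y - z‖ ((1 + ‖y‖) / 2) with hnear | hnear
  · refine le_trans ?_ (le_add_of_le_of_nonneg (le_add_of_nonneg_right h₂) h₃)
    rw [Set.indicator_of_mem (Set.mem_Iic.2 hnear), mul_comm]
    gcongr ?_ * _
    exact rpow_le_rpow_of_nonpos (by positivity) (by linarith) (by linarith)
  rcases le_or_gt ‖z‖ (2 * (1 + ‖y‖)) with hmid | hfar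
  · refine le_trans ?_ (le_add_of_le_of_nonneg (le_add_of_nonneg_left h₁) h₃)
    rw [Set.indicator_of_mem (Set.mem_Iic.2 hmid)]
    gcongr ?_ * _
    exact rpow_le_rpow_of_nonpos (by positivity) hnear.le (by linarith)
  · refine le_trans ?_ (le_add_of_nonneg_left (add_nonneg h₁ h₂))
    have hz0 : 0 < ‖z‖ := by linarith
    rw [Set.indicator_of_mem (Set.mem_Ioi.2 hfar), sub_eq_add_neg _ (N : ℝ), rpow_add hz0,
      ← mul_assoc, ← mul_rpow (by norm_num) hz]
    gcongr ?_ * ?_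
    · exact rpow_le_rpow_of_nonpos (by positivity) (by linarith) (by linarith)
    · exact rpow_le_rpow_of_nonpos (by positivity) (by linarith) (by linarith)

/-- Convolution estimate, borderline case `σ = N - 2`: there is a constant `C > 0` such
that for every `y ∈ ℝ^N`,
`∫_{ℝ^N} |y - z|^{-(N-2)} (1 + |z|)^{-(2+(N-2))} dz ≤ C log(2 + |y|) (1 + |y|)^{-(N-2)}`. -/
theorem convolution_estimate_critical {N : ℕ} (hN : 3 ≤ N) :
    ∃ C : ℝ, 0 < C ∧ ∀ y : EuclideanSpace ℝ (Fin N),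
      (∫ z : EuclideanSpace ℝ (Fin N),
          ‖y - z‖ ^ (-((N : ℝ) - 2)) * (1 + ‖z‖) ^ (-(2 + ((N : ℝ) - 2))))
        ≤ C * Real.log (2 + ‖y‖) * (1 + ‖y‖) ^ (-((N : ℝ) - 2)) := by
  have hN' : (3 : ℝ) ≤ N := by exact_mod_cast hN
  set κ : ℝ := N * volume.real (Metric.ball (0 : EuclideanSpace ℝ (Fin N)) 1) with hκ
  have hκ0 : 0 ≤ κ := by positivity
  set A : ℝ := (1 / 2) ^ (-((N : ℝ) - 2)) with hA
  have hA0 : 0 < A := by positivity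
  refine ⟨5 * A * κ + 1, by positivity, fun y => ?_⟩
  set R : ℝ := 1 + ‖y‖ with hR
  have hR1 : 1 ≤ R := by simp [hR]
  have hR0 : 0 < R := by linarith
  obtain ⟨hi₁, hle₁⟩ := radial_estimate_near hN (R := R / 2) (by positivity)
  obtain ⟨hi₂, hle₂⟩ := radial_estimate_middle hN (R := 2 * R) (by positivity)
  obtain ⟨hi₃, hle₃⟩ := radial_estimate_far hN (R := 2 * R) (by positivity)
  have hi₁' := hi₁.comp_sub_left y
  rw [← integral_sub_left_eq_self _ volume y] at hle₁
  rw [← hκ] at hle₁ hle₂ hle₃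
  set p : ℝ := R ^ (-((N : ℝ) - 2)) with hp
  have hp0 : 0 < p := by positivity
  have hhalf : (R / 2) ^ (-((N : ℝ) - 2)) = A * p := by
    rw [hA, hp, ← mul_rpow (by norm_num) hR0.le]
    ring_nf
  have hhalf' : (R / 2) ^ (-(N : ℝ)) * (R / 2) ^ 2 = A * p := by
    rw [← hhalf, ← rpow_natCast (R / 2) 2, ← rpow_add (by positivity)]
    congr 1
    push_cast
    ring
  have hfar : (2 * R) ^ (-((N : ℝ) - 2)) / ((N : ℝ) - 2) ≤ p := by
    refine (div_le_self (by positivity) (by linarith)).trans ?_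
    exact rpow_le_rpow_of_nonpos hR0 (by linarith) (by linarith)
  have hlog : log (1 + 2 * R) ≤ 2 * log (2 + ‖y‖) := by
    have : 2 * log (2 + ‖y‖) = log ((2 + ‖y‖) ^ 2) := by simp
    rw [this]
    refine log_le_log (by positivity) ?_
    rw [hR]
    nlinarith [norm_nonneg y]
  have hlog' : 1 / 2 ≤ log (2 + ‖y‖) :=
    (by linarith [log_two_gt_d9] : (1 / 2 : ℝ) ≤ log 2).trans
      (log_le_log (by norm_num) (by linarith [norm_nonneg y]))
  rw [show (2 : ℝ) + ((N : ℝ) - 2) = N by ring]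
  refine (integral_mono_of_nonneg (Filter.Eventually.of_forall fun z => by positivity)
    (((hi₁'.const_mul _).add (hi₂.const_mul _)).add (hi₃.const_mul _))
    (Filter.Eventually.of_forall fun z => kernel_le_sum_radial hN y z)).trans ?_
  rw [integral_add' ((hi₁'.const_mul _).add (hi₂.const_mul _)) (hi₃.const_mul _),
    integral_add' (hi₁'.const_mul _) (hi₂.const_mul _), integral_const_mul, integral_const_mul,
    integral_const_mul, ← hR, hhalf, ← hA]
  calc _ ≤ (R / 2) ^ (-(N : ℝ)) * (κ * ((R / 2) ^ 2 / 2)) + A * p * (κ * log (1 + 2 * R)) +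
        A * (κ * ((2 * R) ^ (-((N : ℝ) - 2)) / ((N : ℝ) - 2))) := by gcongr
    _ ≤ A * p * κ / 2 + A * p * (κ * (2 * log (2 + ‖y‖))) + A * (κ * p) := by
        gcongr
        exact le_of_eq (by linear_combination (κ / 2) * hhalf')
    _ ≤ (5 * A * κ + 1) * log (2 + ‖y‖) * p := by
        have : 0 ≤ A * κ * p := by positivity
        nlinarith [mul_le_mul_of_nonneg_left hlog' this, mul_le_mul_of_nonneg_left hlog' hp0.le]
end
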